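/- Let Γ = (V, E) be a finite irreflexive graph (E symmetric and containing no loops). The following are equivalent: (i) Γ is an apartness relation, i.e., whenever (a, b) ∈ E, then for every c ∈ V one has (a, c) ∈ E or (c, b) ∈ E (equivalently, the complement of E together with all loops is an equivalence relation on V); (ii) Γ has depth at most 2, i.e., Γ admits no paw of depth 3. Moreover, every such graph is a cograph. -/

import Mathlib

/-- A graph `(V, E)` (with `E` a symmetric relation, loops permitted) is a *cograph*
iff for all `w, x, y, z`, if `(w,x) ∈ E`, `(y,x) ∈ E` and `(y,z) ∈ E`, then
`(y,w) ∈ E` or `(w,z) ∈ E` or `(z,x) ∈ E`. -/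
def IsCograph {V : Type*} (E : V → V → Prop) : Prop :=
  ∀ w x y z : V, E w x → E y x → E y z → E y w ∨ E w z ∨ E z x

/-- A *paw of depth `k`* in `(V, E)` is a sequence `x₁, …, x_k` of vertices with
`x₁ ≠ x₂` such that for all `1 ≤ i < j ≤ k`, `(x_i, x_j) ∈ E` iff `j` is even.
(Here `x : Fin k → V` is `0`-indexed, so index `j : Fin k` corresponds to `j + 1`.) -/
def IsPaw {V : Type*} (E : V → V → Prop) (k : ℕ) (x : Fin k → V) : Prop :=
  (∀ h : 2 ≤ k, x ⟨0, by omega⟩ ≠ x ⟨1, by omega⟩) ∧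
    ∀ i j : Fin k, i < j → (E (x i) (x j) ↔ Even ((j : ℕ) + 1))

/-- The *depth* of `(V, E)`: the supremum of the `k` for which there is a paw of
depth `k`. -/
noncomputable def depth {V : Type*} (E : V → V → Prop) : ℕ :=
  sSup {k : ℕ | ∃ x : Fin k → V, IsPaw E k x}

section

variable {V : Type*} {E : V → V → Prop}

theorem IsPaw.injective (hsymm : ∀ ⦃a b : V⦄, E a b → E b a)
    (hirr : ∀ v : V, ¬ E v v) {k : ℕ} {x : Fin k → V}
    (h : IsPaw E k x) : Function.Injective x := by
  refine Function.Injective.of_lt_imp_ne fun i j hij heq => ?_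
  by_cases hj : Even ((j : ℕ) + 1)
  · exact hirr _ (heq ▸ (h.2 i j hij).2 hj)
  have hlt : (i : ℕ) < j := hij
  have hjk := j.isLt
  by_cases hi : Even ((i : ℕ) + 1)
  · have hi0 : 0 < (i : ℕ) := by grind
    let m : Fin k := ⟨0, by omega⟩
    have hmi : E (x m) (x i) := (h.2 m i hi0).2 hi
    exact hj ((h.2 m j (hi0.trans hlt)).1 (heq ▸ hmi))
  · have hmj : (i : ℕ) + 1 < j := by grind
    let m : Fin k := ⟨i + 1, by omega⟩
    have him : E (x i) (x m) := (h.2 i m (Nat.lt_succ_self _)).2 (by grind)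
    exact hj ((h.2 m j hmj).1 (hsymm (heq ▸ him)))

theorem IsPaw.comp_castLE {k l : ℕ} {x : Fin l → V} (h : IsPaw E l x) (hkl : k ≤ l) :
    IsPaw E k (x ∘ Fin.castLE hkl) :=
  ⟨fun hk => h.1 (hk.trans hkl), fun i j hij => h.2 (Fin.castLE hkl i) (Fin.castLE hkl j) hij⟩

theorem depth_le_iff_not_exists_isPaw [Finite V] (hsymm : ∀ ⦃a b : V⦄, E a b → E b a)
    (hirr : ∀ v : V, ¬ E v v)
    (n : ℕ) : depth E ≤ n ↔ ¬ ∃ x : Fin (n + 1) → V, IsPaw E (n + 1) x := by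
  have hbdd : BddAbove {k : ℕ | ∃ x : Fin k → V, IsPaw E k x} := by
    refine ⟨Nat.card V, ?_⟩
    rintro k ⟨x, hx⟩
    simpa using Nat.card_le_card_of_injective x (hx.injective hsymm hirr)
  constructor
  · intro hd hpaw
    have hle : n + 1 ≤ depth E := le_csSup hbdd hpaw
    omega
  · intro hno
    refine csSup_le' ?_
    rintro k ⟨x, hx⟩
    by_contra! hk
    exact hno ⟨_, hx.comp_castLE hk⟩

theorem exists_isPaw_three_iff (hirr : ∀ v : V, ¬ E v v) :
    (∃ x : Fin 3 → V, IsPaw E 3 x) ↔ ∃ a b c : V, E a b ∧ ¬ E a c ∧ ¬ E b c := by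
  constructor
  · rintro ⟨x, hx⟩
    refine ⟨x 0, x 1, x 2, (hx.2 0 1 (by decide)).2 (by decide), fun h => ?_, fun h => ?_⟩
    · exact absurd ((hx.2 0 2 (by decide)).1 h) (by decide)
    · exact absurd ((hx.2 1 2 (by decide)).1 h) (by decide)
  · rintro ⟨a, b, c, hab, hac, hbc⟩
    refine ⟨![a, b, c], fun _ => ?_, fun i j hij => ?_⟩
    · rintro h
      obtain rfl : a = b := h
      exact hirr _ hab
    · fin_cases i <;> fin_cases j <;> simp_all <;> decide

end

/-- Let `Γ = (V, E)` be a finite irreflexive graph (`E` symmetric, no loops).  Then: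
`Γ` is an apartness relation (whenever `(a,b) ∈ E`, for every `c` one has `(a,c) ∈ E`
or `(c,b) ∈ E`) iff `Γ` has depth at most `2`, i.e. iff `Γ` admits no paw of
depth `3`.  Moreover, every such graph is a cograph. -/
theorem apartness_iff_depth_le_two {V : Type*} [Fintype V]
    (E : V → V → Prop) (hsymm : Symmetric E) (hirr : ∀ v : V, ¬ E v v) :
    ((∀ a b : V, E a b → ∀ c : V, E a c ∨ E c b) ↔ depth E ≤ 2) ∧
    (depth E ≤ 2 ↔ ¬ ∃ x : Fin 3 → V, IsPaw E 3 x) ∧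
    ((∀ a b : V, E a b → ∀ c : V, E a c ∨ E c b) → IsCograph E) := by
  have hdepth : depth E ≤ 2 ↔ ¬ ∃ x : Fin 3 → V, IsPaw E 3 x :=
    depth_le_iff_not_exists_isPaw hsymm hirr 2
  refine ⟨?_, hdepth, fun h w x y z hwx _ _ => Or.inr (h w x hwx z)⟩
  rw [hdepth, exists_isPaw_three_iff hirr]
  constructor
  · rintro h ⟨a, b, c, hab, hac, hbc⟩
    exact (h a b hab c).elim hac fun hcb => hbc (hsymm hcb)
  · intro h a b hab c
    by_contra! hc
    exact h ⟨a, b, c, hab, hc.1, fun hbc => hc.2 (hsymm hbc)⟩
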